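/- There exist a constant c > 0 and a threshold d₀ such that for every integer d ≥ d₀ and every integer n ≥ 2d the following holds: for every set S of n points in general position in ℝ^d, the number of unordered pairs {A, B} of disjoint d-element subsets of S such that the intrinsic (relative) interiors of the convex hulls of A and of B have a common point is at least c · (2^d · (log d) / √d) · C(n, 2d), where C(n, 2d) is the binomial coefficient. -/

import Mathlib

/-- A finite set of points in `ℝ^d` is in general position if every subset of at most
`d + 1` of the points is affinely independent. -/
def GenPos (d : ℕ) (S : Finset (EuclideanSpace ℝ (Fin d))) : Prop :=
  ∀ T ⊆ S, T.card ≤ d + 1 →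
    AffineIndependent ℝ (fun p : (T : Set (EuclideanSpace ℝ (Fin d))) =>
      (p : EuclideanSpace ℝ (Fin d)))

/-- The set of unordered pairs `{A, B}` of disjoint `k`-element subsets of `S` such that
the intrinsic (relative) interiors of the convex hulls of `A` and `B` intersect. -/
def crossingPairs (d k : ℕ) (S : Finset (EuclideanSpace ℝ (Fin d))) :
    Set (Sym2 (Finset (EuclideanSpace ℝ (Fin d)))) :=
  {q | ∃ A B : Finset (EuclideanSpace ℝ (Fin d)), q = s(A, B) ∧ A ⊆ S ∧ B ⊆ S ∧
    Disjoint A B ∧ A.card = k ∧ B.card = k ∧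
    (intrinsicInterior ℝ (convexHull ℝ (A : Set (EuclideanSpace ℝ (Fin d)))) ∩
      intrinsicInterior ℝ (convexHull ℝ (B : Set (EuclideanSpace ℝ (Fin d))))).Nonempty}

open Finset

theorem exists_threshold {ι : Type*} [DecidableEq ι] (Z : Finset ι) (x y : ι → ℝ)
    (hy : ∀ i ∈ Z, y i ≠ 0)
    (hinj : ∀ i ∈ Z, ∀ j ∈ Z, -x i / y i = -x j / y j → i = j)
    (hpn : #{i ∈ Z | y i < 0} ≤ #{i ∈ Z | 0 < y i}) :
    ∃ t : ℝ, (∀ i ∈ Z, x i + t * y i ≠ 0) ∧ #{i ∈ Z | 0 < x i + t * y i} = #Z / 2 := by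
  classical
  set r : ι → ℝ := fun i => -x i / y i with hr
  have hsum : #{i ∈ Z | y i < 0} + #{i ∈ Z | 0 < y i} = #Z := by
    rw [← card_union_of_disjoint]
    · congr 1
      ext i
      simp only [mem_union, mem_filter]
      constructor
      · tauto
      · intro h
        rcases lt_or_gt_of_ne (hy i h) with h1 | h1 <;> tauto
    · rw [disjoint_left]
      intro i
      simp only [mem_filter]
      intro h1 h2
      linarith [h1.2, h2.2]
  let g : Finset ι → ℕ := fun L => #{i ∈ L | 0 < y i} + #{i ∈ Z \ L | y i < 0}
  let F : Finset (Finset ι) := {L ∈ Z.powerset | (∀ i ∈ L, ∀ j ∈ Z \ L, r i < r j) ∧ g L ≤ #Z / 2}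
  have hF : F.Nonempty := by
    refine ⟨∅, ?_⟩
    simp only [F, g, mem_filter, mem_powerset]
    refine ⟨by simp, by simp, ?_⟩
    simp
    omega
  obtain ⟨L, hLF, hmax⟩ := F.exists_max_image card hF
  simp only [F, mem_filter, mem_powerset] at hLF
  obtain ⟨hLZ, hlow, hgL⟩ := hLF
  have hgeq : g L = #Z / 2 := by
    by_contra hne
    have hlt : g L < #Z / 2 := lt_of_le_of_ne hgL hne
    have hne' : (Z \ L).Nonempty := by
      rw [sdiff_nonempty]
      intro h
      have : L = Z := hLZ.antisymm h
      subst this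
      simp [g] at hlt
      omega
    obtain ⟨i, hi, himin⟩ := (Z \ L).exists_min_image r hne'
    rw [mem_sdiff] at hi
    have hcard := hmax (insert i L) (by
      simp only [F, mem_filter, mem_powerset]
      refine ⟨insert_subset hi.1 hLZ, ?_, ?_⟩
      · intro a ha j hj
        rw [mem_sdiff, mem_insert, not_or] at hj
        have hj' : j ∈ Z \ L := mem_sdiff.2 ⟨hj.1, hj.2.2⟩
        rcases mem_insert.1 ha with rfl | ha
        · refine lt_of_le_of_ne (himin j hj') ?_
          intro h
          exact hj.2.1 (hinj _ hi.1 _ hj.1 h).symm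
        · exact hlow a ha j hj'
      · have h1 : #{a ∈ insert i L | 0 < y a} ≤ #{a ∈ L | 0 < y a} + 1 := by
          rw [filter_insert]
          split_ifs
          · exact card_insert_le _ _
          · omega
        have h2 : #{a ∈ Z \ insert i L | y a < 0} ≤ #{a ∈ Z \ L | y a < 0} := by
          apply card_le_card
          intro a
          simp only [mem_filter, mem_sdiff, mem_insert]
          tauto
        simp only [g] at hlt ⊢
        omega)
    rw [card_insert_of_notMem hi.2] at hcard
    omega
  obtain ⟨t, ht1, ht2⟩ := Order.exists_between_finsets (lo := L.image r) (hi := (Z \ L).image r) (by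
    intro a ha b hb
    obtain ⟨i, hi, rfl⟩ := mem_image.1 ha
    obtain ⟨j, hj, rfl⟩ := mem_image.1 hb
    exact hlow i hi j hj)
  have key : ∀ i ∈ Z, x i + t * y i = y i * (t - r i) := by
    intro i hi
    have := hy i hi
    simp only [hr]
    field_simp
    ring
  have hL1 : ∀ i ∈ L, 0 < t - r i := fun i hi => sub_pos.2 (ht1 _ (mem_image_of_mem r hi))
  have hL2 : ∀ i ∈ Z, i ∉ L → t - r i < 0 := fun i hi hi' =>
    sub_neg.2 (ht2 _ (mem_image_of_mem r (mem_sdiff.2 ⟨hi, hi'⟩)))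
  refine ⟨t, ?_, ?_⟩
  · intro i hi
    rw [key i hi]
    refine mul_ne_zero (hy i hi) ?_
    by_cases h : i ∈ L
    · exact (hL1 i h).ne'
    · exact (hL2 i hi h).ne
  · rw [← hgeq]
    simp only [g]
    rw [← card_union_of_disjoint]
    · congr 1
      ext i
      simp only [mem_union, mem_filter, mem_sdiff]
      constructor
      · rintro ⟨hi, h⟩
        rw [key i hi] at h
        by_cases hL : i ∈ L
        · left
          exact ⟨hL, pos_of_mul_pos_left h (hL1 i hL).le⟩
        · right
          refine ⟨⟨hi, hL⟩, ?_⟩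
          have := hL2 i hi hL
          nlinarith
      · rintro (⟨hL, h⟩ | ⟨⟨hi, hL⟩, h⟩)
        · refine ⟨hLZ hL, ?_⟩
          rw [key i (hLZ hL)]
          exact mul_pos h (hL1 i hL)
        · refine ⟨hi, ?_⟩
          rw [key i hi]
          exact mul_pos_of_neg_of_neg h (hL2 i hi hL)
    · rw [disjoint_left]
      intro i
      simp only [mem_filter, mem_sdiff]
      tauto

theorem exists_threshold' {ι : Type*} [DecidableEq ι] (Z : Finset ι) (x y : ι → ℝ)
    (hy : ∀ i ∈ Z, y i ≠ 0)
    (hinj : ∀ i ∈ Z, ∀ j ∈ Z, -x i / y i = -x j / y j → i = j) :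
    ∃ t : ℝ, (∀ i ∈ Z, x i + t * y i ≠ 0) ∧ #{i ∈ Z | 0 < x i + t * y i} = #Z / 2 := by
  rcases le_total #{i ∈ Z | y i < 0} #{i ∈ Z | 0 < y i} with h | h
  · exact exists_threshold Z x y hy hinj h
  · obtain ⟨t, h1, h2⟩ := exists_threshold Z x (fun i => - y i) (by simpa using hy) (by
      intro i hi j hj h
      simp only [neg_div_neg_eq] at h
      refine hinj i hi j hj ?_
      rw [neg_div, neg_div, h]) (by simpa using h)
    refine ⟨-t, ?_, ?_⟩
    · intro i hi
      have := h1 i hi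
      rwa [mul_neg, ← neg_mul] at this
    · rw [← h2]
      simp only [mul_neg, neg_mul]


theorem count_bound {α : Type*} [DecidableEq α] (a b : ℕ) (U : Finset α)
    (hU : #U = 2 * (a + b + 3)) (X : Finset (Finset α))
    (hX : ∀ A ∈ X, A ⊆ U ∧ #A = a + b + 3)
    (h : ∀ Z ⊆ U, #Z = a + b + 6 → ∃ P ⊆ Z, #P = b + 3 ∧
      ∀ A ⊆ U, #A = a + b + 3 → A ∩ Z = P → A ∈ X) :
    (2 * (a + b + 3)).choose (a + b + 6) * (a + b).choose a ≤
      #X * ((a + b + 3).choose (b + 3) * (a + b + 3).choose (a + 3)) := by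
  classical
  have h' : ∀ Z, ∃ P, Z ⊆ U → #Z = a + b + 6 → P ⊆ Z ∧ #P = b + 3 ∧
      ∀ A ⊆ U, #A = a + b + 3 → A ∩ Z = P → A ∈ X := by
    intro Z
    by_cases h1 : Z ⊆ U
    · by_cases h2 : #Z = a + b + 6
      · obtain ⟨P, hP⟩ := h Z h1 h2
        exact ⟨P, fun _ _ => hP⟩
      · exact ⟨∅, fun _ h => absurd h h2⟩
    · exact ⟨∅, fun h => absurd h h1⟩
  choose P hP using h'
  have key := Finset.card_mul_le_card_mul (s := U.powersetCard (a + b + 6)) (t := X)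
    (fun Z A => A ∩ Z = P Z) (m := (a + b).choose a)
    (n := (a + b + 3).choose (b + 3) * (a + b + 3).choose (a + 3)) ?_ ?_
  · rwa [card_powersetCard, hU] at key
  · intro Z hZ
    rw [mem_powersetCard] at hZ
    obtain ⟨hPZ, hPc, hA⟩ := hP Z hZ.1 hZ.2
    have hc : #(U \ Z) = a + b := by
      rw [card_sdiff_of_subset hZ.1, hU, hZ.2]; omega
    rw [← hc, ← card_powersetCard]
    apply card_le_card_of_injOn (fun A' => P Z ∪ A')
    · intro A' hA'
      rw [mem_coe, mem_powersetCard] at hA'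
      have hd : Disjoint Z A' := disjoint_of_subset_right hA'.1 disjoint_sdiff
      have hPint : (P Z ∪ A') ∩ Z = P Z := by
        rw [union_inter_distrib_right, inter_eq_left.2 hPZ, disjoint_iff_inter_eq_empty.1 hd.symm,
          union_empty]
      simp only [bipartiteAbove, coe_filter, Set.mem_ofPred_eq]
      refine ⟨hA _ ?_ ?_ hPint, hPint⟩
      · exact union_subset (hPZ.trans hZ.1) (hA'.1.trans sdiff_subset)
      · rw [card_union_of_disjoint (disjoint_of_subset_left hPZ hd), hPc, hA'.2]; omega
    · intro A1 h1 A2 h2 heq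
      rw [mem_coe, mem_powersetCard] at h1 h2
      have e : ∀ A', A' ⊆ U \ Z → (P Z ∪ A') \ Z = A' := by
        intro A' hA'
        have hd : Disjoint Z A' := disjoint_of_subset_right hA' disjoint_sdiff
        rw [union_sdiff_distrib, sdiff_eq_empty_iff_subset.2 hPZ, empty_union,
          sdiff_eq_self_of_disjoint hd.symm]
      rw [← e A1 h1.1, ← e A2 h2.1]
      simp only at heq
      rw [heq]
  · intro A hA
    obtain ⟨hAU, hAc⟩ := hX A hA
    have hc : #(U \ A) = a + b + 3 := by
      rw [card_sdiff_of_subset hAU, hU, hAc]; omega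
    calc _ ≤ #(A.powersetCard (b + 3) ×ˢ (U \ A).powersetCard (a + 3)) := ?_
      _ = _ := by rw [card_product, card_powersetCard, card_powersetCard, hAc, hc]
    apply card_le_card_of_injOn (fun Z => (A ∩ Z, Z \ A))
    · intro Z hZ
      simp only [bipartiteBelow, coe_filter, Set.mem_ofPred_eq, mem_powersetCard] at hZ
      obtain ⟨⟨hZU, hZc⟩, hAZ⟩ := hZ
      obtain ⟨hPZ, hPc, -⟩ := hP Z hZU hZc
      simp only [coe_product, Set.mem_prod, mem_coe, mem_powersetCard]
      have h1 : #(A ∩ Z) = b + 3 := by rw [hAZ, hPc]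
      refine ⟨⟨inter_subset_left, h1⟩, sdiff_subset_sdiff hZU le_rfl, ?_⟩
      have := card_sdiff_add_card_inter Z A
      rw [inter_comm] at this
      omega
    · intro Z1 _ Z2 _ heq
      simp only [Prod.mk.injEq] at heq
      rw [← sdiff_union_inter Z1 A, ← sdiff_union_inter Z2 A, inter_comm Z1, inter_comm Z2,
        heq.1, heq.2]

theorem choose_identity (a b : ℕ) :
    (2 * (a + b + 3)).choose (a + b + 6) * (a + b).choose a * (a + b + 6).choose (b + 3) =
    (2 * (a + b + 3)).choose (a + b + 3) *
      ((a + b + 3).choose (b + 3) * (a + b + 3).choose (a + 3)) := by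
  have e1 : ((2 * (a + b + 3)).choose (a + b + 6) : ℚ) =
      (2 * (a + b + 3)).factorial / ((a + b + 6).factorial * (a + b).factorial) := by
    rw [show 2 * (a + b + 3) = (a + b + 6) + (a + b) by ring, Nat.cast_add_choose]
  have e2 : ((a + b).choose a : ℚ) = (a + b).factorial / (a.factorial * b.factorial) := by
    rw [Nat.cast_add_choose]
  have e3 : ((a + b + 6).choose (b + 3) : ℚ) =
      (a + b + 6).factorial / ((b + 3).factorial * (a + 3).factorial) := by
    rw [show a + b + 6 = (b + 3) + (a + 3) by ring, Nat.cast_add_choose]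
  have e4 : ((2 * (a + b + 3)).choose (a + b + 3) : ℚ) =
      (2 * (a + b + 3)).factorial / ((a + b + 3).factorial * (a + b + 3).factorial) := by
    rw [show 2 * (a + b + 3) = (a + b + 3) + (a + b + 3) by ring, Nat.cast_add_choose]
  have e5 : ((a + b + 3).choose (b + 3) : ℚ) =
      (a + b + 3).factorial / ((b + 3).factorial * a.factorial) := by
    rw [show a + b + 3 = (b + 3) + a by ring, Nat.cast_add_choose]
  have e6 : ((a + b + 3).choose (a + 3) : ℚ) =
      (a + b + 3).factorial / ((a + 3).factorial * b.factorial) := by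
    rw [show a + b + 3 = (a + 3) + b by ring, Nat.cast_add_choose]
  have : ((2 * (a + b + 3)).choose (a + b + 6) * (a + b).choose a * (a + b + 6).choose (b + 3) : ℚ)
    = (2 * (a + b + 3)).choose (a + b + 3) *
      ((a + b + 3).choose (b + 3) * (a + b + 3).choose (a + 3)) := by
    rw [e1, e2, e3, e4, e5, e6]
    have f := fun n : ℕ => (Nat.cast_ne_zero (R := ℚ)).2 n.factorial_ne_zero
    have := f (a + b + 6)
    have := f (a + b + 3)
    have := f (a + b)
    have := f (a + 3)
    have := f (b + 3)
    have := f a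
    have := f b
    field_simp
  exact_mod_cast this

theorem count_bound' {α : Type*} [DecidableEq α] (a b : ℕ) (U : Finset α)
    (hU : #U = 2 * (a + b + 3)) (X : Finset (Finset α))
    (hX : ∀ A ∈ X, A ⊆ U ∧ #A = a + b + 3)
    (h : ∀ Z ⊆ U, #Z = a + b + 6 → ∃ P ⊆ Z, #P = b + 3 ∧
      ∀ A ⊆ U, #A = a + b + 3 → A ∩ Z = P → A ∈ X) :
    Nat.centralBinom (a + b + 3) ≤ #X * (a + b + 6).choose (b + 3) := by
  have h1 := count_bound a b U hU X hX h
  have h2 := choose_identity a b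
  have hpos : 0 < (a + b + 3).choose (b + 3) * (a + b + 3).choose (a + 3) :=
    Nat.mul_pos (Nat.choose_pos (by omega)) (Nat.choose_pos (by omega))
  rw [Nat.centralBinom]
  refine Nat.le_of_mul_le_mul_right (c := (a + b + 3).choose (b + 3) * (a + b + 3).choose (a + 3)) ?_ hpos
  rw [← h2]
  calc _ ≤ _ := Nat.mul_le_mul_right _ h1
    _ = _ := by ring

theorem cb_lower (n : ℕ) (hn : 1 ≤ n) : 16 ^ n ≤ 4 * n * n.centralBinom ^ 2 := by
  induction n, hn using Nat.le_induction with
  | base => simp [Nat.centralBinom, Nat.choose]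
  | succ n hn ih =>
    have h := Nat.succ_mul_centralBinom_succ n
    have : (n + 1) * 16 ^ (n + 1) ≤ (n + 1) * (4 * (n + 1) * (n + 1).centralBinom ^ 2) := by
      calc (n + 1) * 16 ^ (n + 1) = 16 * (n + 1) * 16 ^ n := by ring
        _ ≤ 16 * (n + 1) * (4 * n * n.centralBinom ^ 2) := Nat.mul_le_mul_left _ ih
        _ = (4 * n * (n + 1)) * (16 * n.centralBinom ^ 2) := by ring
        _ ≤ ((2 * n + 1) ^ 2) * (16 * n.centralBinom ^ 2) := by
          apply Nat.mul_le_mul_right; nlinarith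
        _ = 4 * (2 * (2 * n + 1) * n.centralBinom) ^ 2 := by ring
        _ = 4 * ((n + 1) * (n + 1).centralBinom) ^ 2 := by rw [h]
        _ = _ := by ring
    exact Nat.le_of_mul_le_mul_left this (by omega)

theorem cb_upper (n : ℕ) : (2 * n + 1) * n.centralBinom ^ 2 ≤ 16 ^ n := by
  induction n with
  | zero => simp
  | succ n ih =>
    have h := Nat.succ_mul_centralBinom_succ n
    have : (n + 1) ^ 2 * ((2 * (n + 1) + 1) * (n + 1).centralBinom ^ 2) ≤
        (n + 1) ^ 2 * 16 ^ (n + 1) := by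
      calc _ = (2 * n + 3) * ((n + 1) * (n + 1).centralBinom) ^ 2 := by ring
        _ = (2 * n + 3) * (2 * (2 * n + 1) * n.centralBinom) ^ 2 := by rw [h]
        _ = 4 * (2 * n + 3) * (2 * n + 1) * ((2 * n + 1) * n.centralBinom ^ 2) := by ring
        _ ≤ 4 * (2 * n + 3) * (2 * n + 1) * 16 ^ n := Nat.mul_le_mul_left _ ih
        _ ≤ (16 * (n + 1) ^ 2) * 16 ^ n := by
          apply Nat.mul_le_mul_right; nlinarith
        _ = _ := by ring
    exact Nat.le_of_mul_le_mul_left this (by positivity)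

/-- final numeric bound -/
theorem numeric (d p N : ℕ) (hd : 1 ≤ d)
    (h : Nat.centralBinom d ≤ N * (d + 3).choose p) : 2 ^ d ≤ 32 * N := by
  set m := (d + 4) / 2
  have h1 : (d + 3).choose p ≤ m.centralBinom :=
    (Nat.choose_le_choose p (by omega)).trans (Nat.choose_le_centralBinom p m)
  have h2 := cb_lower d hd
  have h3 := cb_upper m
  have h4 : (16 : ℕ) ^ m ≤ 4 ^ (d + 4) := by
    rw [show (16 : ℕ) = 4 ^ 2 by norm_num, ← pow_mul]
    exact Nat.pow_le_pow_right (by norm_num) (by omega)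
  have h5 : d.centralBinom ^ 2 ≤ N ^ 2 * m.centralBinom ^ 2 := by
    rw [← mul_pow]
    exact Nat.pow_le_pow_left (h.trans (Nat.mul_le_mul_left _ h1)) 2
  have h6 : d * 16 ^ d ≤ d * (4 ^ d * (32 * N) ^ 2) := by
    calc d * 16 ^ d ≤ (2 * m + 1) * (4 * d * d.centralBinom ^ 2) :=
          Nat.mul_le_mul (by omega) h2
      _ ≤ (2 * m + 1) * (4 * d * (N ^ 2 * m.centralBinom ^ 2)) := by gcongr
      _ = 4 * d * N ^ 2 * ((2 * m + 1) * m.centralBinom ^ 2) := by ring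
      _ ≤ 4 * d * N ^ 2 * 4 ^ (d + 4) := by gcongr; exact h3.trans h4
      _ = _ := by ring
  have h7 := Nat.le_of_mul_le_mul_left h6 (by omega)
  have h8 : 4 ^ d * (2 ^ d) ^ 2 ≤ 4 ^ d * (32 * N) ^ 2 := by
    convert h7 using 1
    rw [← pow_mul, mul_comm d 2, pow_mul, ← mul_pow]
    norm_num
  exact (Nat.pow_le_pow_iff_left (by norm_num)).1 (Nat.le_of_mul_le_mul_left h8 (by positivity))

theorem log_le (d : ℕ) (hd : 1 ≤ d) : Real.log d / Real.sqrt d ≤ 2 := by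
  have h0 : (0:ℝ) < d := by exact_mod_cast hd
  have hs : 0 < Real.sqrt d := Real.sqrt_pos.2 h0
  rw [div_le_iff₀ hs]
  have h1 : Real.log d = 2 * Real.log (Real.sqrt d) := by
    rw [Real.log_sqrt h0.le]; ring
  have h2 := Real.log_le_sub_one_of_pos hs
  rw [h1]; linarith


theorem mem_intrinsic {E : Type*} [NormedAddCommGroup E] [NormedSpace ℝ E] [FiniteDimensional ℝ E]
    (A : Finset E) (hA : AffineIndependent ℝ (fun p : (A : Set E) => (p : E)))
    (w : E → ℝ) (hw : ∀ a ∈ A, 0 < w a) (hs : ∑ a ∈ A, w a = 1) :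
    ∑ a ∈ A, w a • a ∈ intrinsicInterior ℝ (convexHull ℝ (A : Set E)) := by
  classical
  obtain ⟨T, hAT, hT, hspan⟩ := exists_subset_affineIndependent_affineSpan_eq_top hA
  let b : AffineBasis T ℝ E := ⟨fun p => p, hT, by simpa using hspan⟩
  have hφ : ∃ φ : E → (E →ᵃ[ℝ] ℝ), ∀ a ∈ A, ∀ a' ∈ A, φ a a' = if a = a' then 1 else 0 := by
    refine ⟨fun a => if h : a ∈ T then b.coord ⟨a, h⟩ else AffineMap.const ℝ E 0, ?_⟩
    intro a ha a' ha'
    have h1 : a ∈ T := hAT ha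
    have h2 : a' ∈ T := hAT ha'
    simp only [h1, dif_pos]
    have := b.coord_apply ⟨a, h1⟩ ⟨a', h2⟩
    simp only [Subtype.mk.injEq] at this
    exact this
  obtain ⟨φ, hφ⟩ := hφ
  have hcomb : ∀ v : E → ℝ, ∑ a ∈ A, v a = 1 → ∀ a ∈ A, φ a (∑ x ∈ A, v x • x) = v a := by
    intro v hv a ha
    have h1 := A.map_affineCombination (id : E → E) v hv (φ a)
    rw [Finset.affineCombination_eq_linear_combination _ _ _ hv,
      Finset.affineCombination_eq_linear_combination _ _ _ hv] at h1
    simp only [id, Function.comp] at h1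
    rw [h1, Finset.sum_congr rfl (fun x hx => by rw [hφ a ha x hx])]
    simp [ha]
  have hx : ∑ a ∈ A, w a • a ∈ convexHull ℝ (A : Set E) := by
    rw [Finset.mem_convexHull']
    exact ⟨w, fun a ha => (hw a ha).le, hs, rfl⟩
  rw [mem_intrinsicInterior]
  refine ⟨⟨_, subset_affineSpan ℝ _ hx⟩, ?_, rfl⟩
  rw [mem_interior]
  refine ⟨{y | ∀ a ∈ A, 0 < φ a y}, ?_, ?_, ?_⟩
  · rintro ⟨y, hy⟩ hpos
    simp only [Set.mem_ofPred_eq] at hpos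
    rw [affineSpan_convexHull] at hy
    show y ∈ convexHull ℝ (A : Set E)
    have hy' : y ∈ affineSpan ℝ (id '' (A : Set E)) := by simpa using hy
    obtain ⟨v, hv, hyv⟩ : ∃ v : E → ℝ, ∑ a ∈ A, v a = 1 ∧ y = ∑ a ∈ A, v a • a := by
      have hr : (Set.range (fun p : A => (p : E))) = (A : Set E) := by simp
      rw [← hr] at hy
      obtain ⟨v, hv, hyv⟩ := eq_affineCombination_of_mem_affineSpan_of_fintype hy
      rw [Finset.affineCombination_eq_linear_combination _ _ _ hv] at hyv
      refine ⟨fun e => if h : e ∈ A then v ⟨e, h⟩ else 0, ?_, ?_⟩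
      · rw [← Finset.sum_coe_sort]; simpa using hv
      · rw [← Finset.sum_coe_sort]; simpa using hyv
    rw [Finset.mem_convexHull']
    refine ⟨v, fun a ha => ?_, hv, hyv.symm⟩
    have := hpos a ha
    rw [hyv, hcomb v hv a ha] at this
    exact this.le
  · have : {y : affineSpan ℝ (convexHull ℝ (A : Set E)) | ∀ a ∈ A, 0 < φ a y} =
      ⋂ a ∈ A, {y : affineSpan ℝ (convexHull ℝ (A : Set E)) | 0 < φ a y} := by ext; simp
    rw [this]
    refine isOpen_biInter_finset fun a _ => ?_
    exact isOpen_lt continuous_const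
      ((φ a).continuous_of_finiteDimensional.comp continuous_subtype_val)
  · intro a ha
    show 0 < φ a _
    rw [hcomb w hs a ha]
    exact hw a ha

theorem cross_of_dep {E : Type*} [NormedAddCommGroup E] [NormedSpace ℝ E] [FiniteDimensional ℝ E]
    (A B : Finset E) (hA : AffineIndependent ℝ (fun p : (A : Set E) => (p : E)))
    (hB : AffineIndependent ℝ (fun p : (B : Set E) => (p : E))) (hne : A.Nonempty)
    (v : E → ℝ) (h1 : ∀ a ∈ A, 0 < v a) (h2 : ∀ a ∈ B, v a < 0)
    (hs : ∑ a ∈ A, v a + ∑ a ∈ B, v a = 0) (hc : ∑ a ∈ A, v a • a + ∑ a ∈ B, v a • a = 0) :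
    (intrinsicInterior ℝ (convexHull ℝ (A : Set E)) ∩
      intrinsicInterior ℝ (convexHull ℝ (B : Set E))).Nonempty := by
  set s := ∑ a ∈ A, v a with hsdef
  have hspos : 0 < s := sum_pos h1 hne
  have m1 := mem_intrinsic A hA (fun a => v a / s) (fun a ha => div_pos (h1 a ha) hspos)
    (by rw [← sum_div]; exact div_self hspos.ne')
  have m2 := mem_intrinsic B hB (fun a => - v a / s)
    (fun a ha => div_pos (neg_pos.2 (h2 a ha)) hspos)
    (by rw [← sum_div, sum_neg_distrib, div_eq_one_iff_eq hspos.ne']; linarith)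
  refine ⟨_, m1, ?_⟩
  convert m2 using 1
  have e1 : ∑ a ∈ A, (v a / s) • a = s⁻¹ • ∑ a ∈ A, v a • a := by
    rw [smul_sum]; refine sum_congr rfl fun a _ => ?_
    rw [smul_smul]; congr 1; ring
  have e2 : ∑ a ∈ B, (- v a / s) • a = - (s⁻¹ • ∑ a ∈ B, v a • a) := by
    rw [smul_sum, ← sum_neg_distrib]; refine sum_congr rfl fun a _ => ?_
    rw [smul_smul, ← neg_smul]; congr 1; ring
  rw [e1, e2, ← smul_neg, eq_neg_of_add_eq_zero_left hc]


theorem exists_indep_pair {W : Type*} [AddCommGroup W] [Module ℝ W]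
    (h : 1 < Module.finrank ℝ W) :
    ∃ a b : W, ∀ α β : ℝ, α • a + β • b = 0 → α = 0 ∧ β = 0 := by
  have := Module.nontrivial_of_finrank_pos (R := ℝ) (M := W) (by omega)
  obtain ⟨a, ha⟩ := exists_ne (0 : W)
  obtain ⟨b, hb⟩ := exists_linearIndependent_pair_of_one_lt_finrank h ha
  exact ⟨a, b, fun α β => LinearIndependent.pair_iff.1 hb α β⟩

theorem balanced_pattern {ι : Type*} [Fintype ι] [DecidableEq ι] (k : ℕ)
    (hι : Fintype.card ι = 2 * (k + 3)) (V : Submodule ℝ (ι → ℝ))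
    (hV : k + 2 ≤ Module.finrank ℝ V)
    (hunif : ∀ v ∈ V, ∀ T : Finset ι, k + 2 ≤ #T → (∀ i ∈ T, v i = 0) → v = 0)
    (Z : Finset ι) (hZ : #Z = k + 6) :
    ∃ P ⊆ Z, #P = (k + 6) / 2 ∧ ∀ A : Finset ι, A ∩ Z = P →
      ∃ v ∈ V, ∀ i, (i ∈ A → 0 < v i) ∧ (i ∉ A → v i < 0) := by
  have hT : #Zᶜ = k := by rw [card_compl, hι, hZ]; omega
  let ρ : V →ₗ[ℝ] ((Zᶜ : Finset ι) → ℝ) :=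
    { toFun := fun v i => (v : ι → ℝ) i
      map_add' := fun _ _ => rfl
      map_smul' := fun _ _ => rfl }
  have hker : ∀ v : V, v ∈ LinearMap.ker ρ ↔ ∀ i ∉ Z, (v : ι → ℝ) i = 0 := by
    intro v
    rw [LinearMap.mem_ker]
    constructor
    · intro h i hi
      exact congrFun h ⟨i, by simpa using hi⟩
    · intro h
      funext i
      exact h i (mem_compl.1 i.2)
  -- uniformity in the kernel
  have hun2 : ∀ v : V, v ∈ LinearMap.ker ρ → ∀ i ∈ Z, ∀ j ∈ Z, i ≠ j →
      (v : ι → ℝ) i = 0 → (v : ι → ℝ) j = 0 → v = 0 := by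
    intro v hv i hi j hj hij h1 h2
    rw [hker] at hv
    apply Subtype.ext
    refine hunif v v.2 (insert i (insert j Zᶜ)) ?_ ?_
    · rw [card_insert_of_notMem, card_insert_of_notMem, hT]
      · simpa using hj
      · simp [hij, hi]
    · intro a ha
      rcases mem_insert.1 ha with rfl | ha
      · exact h1
      · rcases mem_insert.1 ha with rfl | ha
        · exact h2
        · exact hv a (by simpa using ha)
  have hrn := ρ.finrank_range_add_finrank_ker
  have hcod : Module.finrank ℝ ((Zᶜ : Finset ι) → ℝ) = k := by
    rw [Module.finrank_fintype_fun_eq_card, Fintype.card_coe, hT]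
  have hrange : Module.finrank ℝ (LinearMap.range ρ) ≤ k := by
    rw [← hcod]; exact Submodule.finrank_le _
  obtain ⟨i0, hi0, j0, hj0, hij0⟩ := one_lt_card.1 (show 1 < #Z by omega)
  have hkle : Module.finrank ℝ (LinearMap.ker ρ) ≤ 2 := by
    let f : LinearMap.ker ρ →ₗ[ℝ] (Fin 2 → ℝ) :=
      { toFun := fun v => ![((v : V) : ι → ℝ) i0, ((v : V) : ι → ℝ) j0]
        map_add' := fun a b => by ext i; fin_cases i <;> simp
        map_smul' := fun a b => by ext i; fin_cases i <;> simp }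
    have hf : Function.Injective f := by
      rw [injective_iff_map_eq_zero]
      intro v hv
      have h0 : ((v : V) : ι → ℝ) i0 = 0 := congrFun hv 0
      have h1 : ((v : V) : ι → ℝ) j0 = 0 := congrFun hv 1
      exact Subtype.ext (hun2 v v.2 i0 hi0 j0 hj0 hij0 h0 h1)
    simpa using LinearMap.finrank_le_finrank_of_injective hf
  have hsurj : LinearMap.range ρ = ⊤ := by
    apply Submodule.eq_top_of_finrank_eq
    omega
  have hk2 : 1 < Module.finrank ℝ (LinearMap.ker ρ) := by omega
  -- two independent vectors
  obtain ⟨k0, k1, hind⟩ := exists_indep_pair (W := ↥(LinearMap.ker ρ)) (by convert hk2)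
  obtain ⟨b0, hb0⟩ := k0
  obtain ⟨b1, hb1⟩ := k1
  have hind' : ∀ α β : ℝ, α • b0 + β • b1 = 0 → α = 0 ∧ β = 0 := fun α β h =>
    hind α β (Subtype.ext h)
  clear hind
  have hmemK : ∀ α β : ℝ, α • b0 + β • b1 ∈ LinearMap.ker ρ := fun α β =>
    Submodule.add_mem _ (Submodule.smul_mem _ _ hb0) (Submodule.smul_mem _ _ hb1)
  set x : ι → ℝ := (b0 : ι → ℝ) with hx
  set y0 : ι → ℝ := (b1 : ι → ℝ) with hy0
  have hcoe : ∀ α β : ℝ, ∀ i, ((α • b0 + β • b1 : V) : ι → ℝ) i = α * x i + β * y0 i :=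
    fun α β i => rfl
  have hcomb : ∀ α β : ℝ, ∀ i ∈ Z, ∀ j ∈ Z, i ≠ j → α * x i + β * y0 i = 0 →
      α * x j + β * y0 j = 0 → α = 0 ∧ β = 0 := by
    intro α β i hi j hj hij h1 h2
    exact hind' α β (hun2 _ (hmemK α β) i hi j hj hij h1 h2)
  have hnz : ∀ i ∈ Z, x i = 0 → y0 i ≠ 0 := by
    intro i hi h1 h2
    obtain ⟨j, hj, hij⟩ := exists_mem_ne (show 1 < #Z by omega) i
    have := hcomb (y0 j) (-x j) i hi j hj hij.symm (by rw [h1, h2]; ring) (by ring)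
    have := hcomb 1 0 i hi j hj hij.symm (by rw [h1]; ring) (by
      have := this.2; simp at this; rw [this]; ring)
    exact one_ne_zero this.1
  obtain ⟨s, hs⟩ := Infinite.exists_notMem_finset (Z.image fun i => - y0 i / x i)
  set y : ι → ℝ := fun i => y0 i + s * x i with hy
  have hyne : ∀ i ∈ Z, y i ≠ 0 := by
    intro i hi h
    simp only [hy] at h
    by_cases hxi : x i = 0
    · rw [hxi] at h
      exact hnz i hi hxi (by simpa using h)
    · apply hs
      rw [mem_image]
      refine ⟨i, hi, ?_⟩
      field_simp
      linarith
  have hinj : ∀ i ∈ Z, ∀ j ∈ Z, -x i / y i = -x j / y j → i = j := by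
    intro i hi j hj h
    by_contra hij
    set t := -x i / y i with ht
    have h1 : x i + t * y i = 0 := by rw [ht]; field_simp [hyne i hi]; ring
    have h2 : x j + t * y j = 0 := by rw [h]; field_simp [hyne j hj]; ring
    simp only [hy] at h1 h2
    have := hcomb (1 + t * s) t i hi j hj hij (by linarith) (by linarith)
    have h3 := this.1
    rw [this.2] at h3
    simp at h3
  obtain ⟨t, ht1, ht2⟩ := exists_threshold' Z x y hyne hinj
  obtain ⟨w, hwK, hwi⟩ : ∃ w : V, w ∈ LinearMap.ker ρ ∧ ∀ i, (w : ι → ℝ) i = x i + t * y i := by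
    refine ⟨_, hmemK (1 + t * s) t, fun i => ?_⟩
    rw [hcoe]
    simp only [hy]
    ring
  simp only [← hwi] at ht1 ht2
  refine ⟨{i ∈ Z | 0 < (w : ι → ℝ) i}, filter_subset _ _, by rw [ht2, hZ], ?_⟩
  intro A hA
  obtain ⟨u, hu⟩ := LinearMap.range_eq_top.1 hsurj
    (fun i : (Zᶜ : Finset ι) => if (i : ι) ∈ A then (1 : ℝ) else -1)
  obtain ⟨ε, hε, hεw⟩ : ∃ ε : ℝ, 0 < ε ∧ ∀ i ∈ Z, ε * |(u : ι → ℝ) i| < |(w : ι → ℝ) i| := by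
    have h1 : ∀ᶠ ε : ℝ in nhdsWithin 0 (Set.Ioi 0), ∀ i ∈ Z,
        ε * |(u : ι → ℝ) i| < |(w : ι → ℝ) i| := by
      rw [Filter.eventually_all_finset]
      intro i hi
      apply Filter.Eventually.filter_mono nhdsWithin_le_nhds
      have hc : ContinuousAt (fun ε : ℝ => ε * |(u : ι → ℝ) i|) 0 := by fun_prop
      apply hc.eventually_lt_const
      simpa using ht1 i hi
    obtain ⟨ε, h, h'⟩ := (h1.and self_mem_nhdsWithin).exists
    exact ⟨ε, h', h⟩
  refine ⟨w + ε • u, (w + ε • u).2, ?_⟩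
  intro i
  simp only [Pi.add_apply, Pi.smul_apply, smul_eq_mul]
  by_cases hi : i ∈ Z
  · have hlt := hεw i hi
    have habs : |ε * (u : ι → ℝ) i| < |(w : ι → ℝ) i| := by rwa [abs_mul, abs_of_pos hε]
    have hb := abs_le.1 (le_refl |ε * (u : ι → ℝ) i|)
    have hmem : i ∈ A ↔ 0 < (w : ι → ℝ) i := by
      have := congrArg (i ∈ ·) hA
      simpa [hi] using this
    constructor
    · intro h
      have h := hmem.1 h
      rw [abs_of_pos h] at habs
      linarith
    · intro h
      have h : (w : ι → ℝ) i < 0 := lt_of_le_of_ne (not_lt.1 (fun h' => h (hmem.2 h'))) (ht1 i hi)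
      rw [abs_of_neg h] at habs
      linarith
  · have hw0 := (hker w).1 hwK i hi
    have hui : (u : ι → ℝ) i = if i ∈ A then 1 else -1 := congrFun hu ⟨i, by simpa using hi⟩
    rw [hw0, hui]
    constructor
    · intro h; simp [h, hε]
    · intro h; simp [h, hε]


theorem pattern_cross (k : ℕ) (U : Finset (EuclideanSpace ℝ (Fin (k + 3))))
    (hU : #U = 2 * (k + 3)) (hgp : GenPos (k + 3) U)
    (Z : Finset (EuclideanSpace ℝ (Fin (k + 3)))) (hZU : Z ⊆ U) (hZ : #Z = k + 6) :
    ∃ P ⊆ Z, #P = (k + 6) / 2 ∧ ∀ A ⊆ U, #A = k + 3 → A ∩ Z = P →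
      (intrinsicInterior ℝ (convexHull ℝ (A : Set (EuclideanSpace ℝ (Fin (k + 3))))) ∩
        intrinsicInterior ℝ (convexHull ℝ
          ((U \ A : Finset (EuclideanSpace ℝ (Fin (k + 3)))) :
            Set (EuclideanSpace ℝ (Fin (k + 3)))))).Nonempty := by
  classical
  let L : (U → ℝ) →ₗ[ℝ] EuclideanSpace ℝ (Fin (k + 3)) × ℝ :=
    (Fintype.linearCombination ℝ (fun i : U => (i : EuclideanSpace ℝ (Fin (k + 3))))).prod
      (Fintype.linearCombination ℝ (fun _ : U => (1 : ℝ)))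
  have hL : ∀ v, v ∈ LinearMap.ker L ↔
      (∑ i, v i • (i : EuclideanSpace ℝ (Fin (k + 3))) = 0 ∧ ∑ i, v i = 0) := by
    intro v
    simp [L, Fintype.linearCombination_apply]
  have hdim : k + 2 ≤ Module.finrank ℝ (LinearMap.ker L) := by
    have h1 := L.finrank_range_add_finrank_ker
    have h2 : Module.finrank ℝ (LinearMap.range L) ≤ k + 3 + 1 := by
      refine (Submodule.finrank_le _).trans ?_
      simp
    rw [Module.finrank_fintype_fun_eq_card, Fintype.card_coe, hU] at h1
    omega
  have hunif : ∀ v ∈ LinearMap.ker L, ∀ T : Finset U, k + 2 ≤ #T → (∀ i ∈ T, v i = 0) → v = 0 := by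
    intro v hv T hT hvT
    rw [hL] at hv
    have hTc : #Tᶜ ≤ k + 4 := by
      rw [card_compl, Fintype.card_coe, hU]; omega
    have hW : Tᶜ.map (Function.Embedding.subtype _) ⊆ U := by
      intro e he
      obtain ⟨i, -, rfl⟩ := mem_map.1 he
      exact i.2
    have hai := hgp (Tᶜ.map (Function.Embedding.subtype _)) hW (by rw [card_map]; omega)
    have hai' : AffineIndependent ℝ
        (fun i : (Tᶜ : Finset U) => ((i : U) : EuclideanSpace ℝ (Fin (k + 3)))) := by
      let f : (Tᶜ : Finset U) ↪ ((Tᶜ.map (Function.Embedding.subtype _) :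
          Finset (EuclideanSpace ℝ (Fin (k + 3)))) : Set (EuclideanSpace ℝ (Fin (k + 3)))) :=
        ⟨fun i => ⟨((i : U) : EuclideanSpace ℝ (Fin (k + 3))), by
          rw [mem_coe, mem_map]; exact ⟨i, i.2, rfl⟩⟩, by
          intro i j hij
          exact Subtype.ext (Subtype.ext (Subtype.mk.inj hij))⟩
      exact hai.comp_embedding f
    rw [affineIndependent_iff] at hai'
    have h := hai' univ (fun i => v i) (by
        rw [univ_eq_attach, sum_attach (Tᶜ) (fun i => v i), ← hv.2]
        refine sum_subset (subset_univ _) fun i _ hi => hvT i (by simpa using hi)) (by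
        rw [univ_eq_attach,
          sum_attach (Tᶜ) (fun i => v i • (i : EuclideanSpace ℝ (Fin (k + 3)))), ← hv.1]
        refine sum_subset (subset_univ _) fun i _ hi => ?_
        rw [hvT i (by simpa using hi), zero_smul])
    funext i
    by_cases hi : i ∈ T
    · exact hvT i hi
    · exact h ⟨i, mem_compl.2 hi⟩ (mem_univ _)
  obtain ⟨P, hPZ, hPc, hP⟩ := balanced_pattern k (by rw [Fintype.card_coe, hU]) (LinearMap.ker L)
    hdim hunif (Z.subtype (· ∈ U)) (by
      rw [card_subtype, filter_true_of_mem (fun e he => hZU he), hZ])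
  refine ⟨P.map (Function.Embedding.subtype _), ?_, by rw [card_map, hPc], ?_⟩
  · intro e he
    obtain ⟨i, hi, rfl⟩ := mem_map.1 he
    exact mem_subtype.1 (hPZ hi)
  intro A hAU hAc hAZ
  obtain ⟨v, hv, hsign⟩ := hP (A.subtype (· ∈ U)) (by
    ext i
    have := congrArg ((i : EuclideanSpace ℝ (Fin (k + 3))) ∈ ·) hAZ
    simpa using this)
  rw [hL] at hv
  let v' : EuclideanSpace ℝ (Fin (k + 3)) → ℝ := fun e => if h : e ∈ U then v ⟨e, h⟩ else 0
  have hBc : #(U \ A) = k + 3 := by rw [card_sdiff_of_subset hAU, hU, hAc]; omega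
  refine cross_of_dep A (U \ A) (hgp A hAU (by omega)) (hgp (U \ A) sdiff_subset (by omega))
    (card_pos.1 (by omega)) v' ?_ ?_ ?_ ?_
  · intro a ha
    have := (hsign ⟨a, hAU ha⟩).1 (by simpa using ha)
    simpa [v', hAU ha] using this
  · intro a ha
    rw [mem_sdiff] at ha
    have := (hsign ⟨a, ha.1⟩).2 (by simpa using ha.2)
    simpa [v', ha.1] using this
  · rw [add_comm, sum_sdiff hAU, ← sum_coe_sort]
    simpa [v'] using hv.2
  · rw [add_comm (∑ a ∈ A, v' a • a), sum_sdiff hAU, ← sum_coe_sort]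
    simpa [v'] using hv.1

theorem crossing_lower_bound_n_points :
    ∃ c : ℝ, 0 < c ∧ ∃ d₀ : ℕ, ∀ d : ℕ, d₀ ≤ d → ∀ n : ℕ, 2 * d ≤ n →
      ∀ S : Finset (EuclideanSpace ℝ (Fin d)), S.card = n → GenPos d S →
        c * (2 ^ d * Real.log d / Real.sqrt d) * (n.choose (2 * d)) ≤
          ((crossingPairs d d S).ncard : ℝ) := by
  classical
  refine ⟨1 / 128, by norm_num, 3, ?_⟩
  intro d hd n hn S hS hgp
  obtain ⟨k, rfl⟩ : ∃ k, d = k + 3 := ⟨d - 3, by omega⟩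
  let cr : Finset (EuclideanSpace ℝ (Fin (k + 3))) → Finset (EuclideanSpace ℝ (Fin (k + 3))) → Prop := fun A B =>
    (intrinsicInterior ℝ (convexHull ℝ (A : Set (EuclideanSpace ℝ (Fin (k + 3))))) ∩
      intrinsicInterior ℝ (convexHull ℝ (B : Set (EuclideanSpace ℝ (Fin (k + 3)))))).Nonempty
  let Y : Finset (Finset (EuclideanSpace ℝ (Fin (k + 3))) × Finset (EuclideanSpace ℝ (Fin (k + 3)))) :=
    {q ∈ S.powersetCard (k + 3) ×ˢ S.powersetCard (k + 3) | Disjoint q.1 q.2 ∧ cr q.1 q.2}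
  have hYmem : ∀ q, q ∈ Y ↔ ((q.1 ⊆ S ∧ #q.1 = k + 3) ∧ (q.2 ⊆ S ∧ #q.2 = k + 3)) ∧
      Disjoint q.1 q.2 ∧ cr q.1 q.2 := by
    intro q
    simp only [Y, mem_filter, mem_product, mem_powersetCard]
  have himg : crossingPairs (k + 3) (k + 3) S = ((Y.image fun q => s(q.1, q.2) : Finset (Sym2 (Finset (EuclideanSpace ℝ (Fin (k + 3)))))) :
      Set (Sym2 (Finset (EuclideanSpace ℝ (Fin (k + 3)))))) := by
    ext q
    simp only [crossingPairs, Set.mem_ofPred_eq, coe_image, Set.mem_image, mem_coe, hYmem]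
    constructor
    · rintro ⟨A, B, rfl, h1, h2, h3, h4, h5, h6⟩
      exact ⟨(A, B), ⟨⟨⟨h1, h4⟩, h2, h5⟩, h3, h6⟩, rfl⟩
    · rintro ⟨⟨A, B⟩, ⟨⟨⟨h1, h4⟩, h2, h5⟩, h3, h6⟩, rfl⟩
      exact ⟨A, B, rfl, h1, h2, h3, h4, h5, h6⟩
  have hncard : #Y ≤ 2 * (crossingPairs (k + 3) (k + 3) S).ncard := by
    rw [himg, Set.ncard_coe_finset]
    apply card_le_mul_card_image
    intro b hb
    obtain ⟨⟨A, B⟩, -, rfl⟩ := mem_image.1 hb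
    refine (card_le_card (t := {(A, B), (B, A)}) ?_).trans card_le_two
    rintro ⟨A', B'⟩ h
    rw [mem_filter] at h
    have h2 := h.2
    simp only [Sym2.eq_iff] at h2
    simp only [mem_insert, mem_singleton, Prod.mk.injEq]
    exact h2
  have hfib : #Y = ∑ U ∈ S.powersetCard (2 * (k + 3)), #{q ∈ Y | q.1 ∪ q.2 = U} := by
    apply card_eq_sum_card_fiberwise
    intro q hq
    rw [mem_coe, hYmem] at hq
    rw [mem_coe, mem_powersetCard]
    refine ⟨union_subset hq.1.1.1 hq.1.2.1, ?_⟩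
    rw [card_union_of_disjoint hq.2.1, hq.1.1.2, hq.1.2.2]; ring
  have hfib2 : ∀ U ∈ S.powersetCard (2 * (k + 3)),
      2 ^ (k + 3) ≤ 32 * #{q ∈ Y | q.1 ∪ q.2 = U} := by
    intro U hU
    rw [mem_powersetCard] at hU
    let X : Finset (Finset (EuclideanSpace ℝ (Fin (k + 3)))) := {A ∈ U.powersetCard (k + 3) | cr A (U \ A)}
    have hXmem : ∀ A, A ∈ X ↔ (A ⊆ U ∧ #A = k + 3) ∧ cr A (U \ A) := by
      intro A; simp only [X, mem_filter, mem_powersetCard]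
    have hXle : #X ≤ #{q ∈ Y | q.1 ∪ q.2 = U} := by
      apply card_le_card_of_injOn (fun A => (A, U \ A))
      · intro A hA
        rw [mem_coe, hXmem] at hA
        rw [mem_coe, mem_filter, hYmem]
        refine ⟨⟨⟨⟨hA.1.1.trans hU.1, hA.1.2⟩, sdiff_subset.trans hU.1, ?_⟩, disjoint_sdiff, hA.2⟩,
          union_sdiff_of_subset hA.1.1⟩
        rw [card_sdiff_of_subset hA.1.1, hU.2, hA.1.2]; omega
      · intro A _ B _ h
        exact (Prod.mk.inj h).1
    obtain ⟨a, b, hab, hb⟩ : ∃ a b, k = a + b ∧ b + 3 = (k + 6) / 2 :=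
      ⟨k - k / 2, k / 2, by omega, by omega⟩
    have hgpU : GenPos (k + 3) U := fun T hT => hgp T (hT.trans hU.1)
    have hcb := count_bound' a b U (by rw [hU.2, hab]) X
      (fun A hA => by rw [← hab]; exact ((hXmem A).1 hA).1) (by
        rw [← hab]
        intro Z hZU hZ
        obtain ⟨P, hPZ, hPc, hP⟩ := pattern_cross k U hU.2 hgpU Z hZU hZ
        refine ⟨P, hPZ, by rw [hPc, hb], fun A hAU hAc hAZ => ?_⟩
        rw [hXmem]
        exact ⟨⟨hAU, hAc⟩, hP A hAU hAc hAZ⟩)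
    rw [← hab] at hcb
    have := numeric (k + 3) (b + 3) #X (by omega) hcb
    omega
  have htot : n.choose (2 * (k + 3)) * 2 ^ (k + 3) ≤
      64 * (crossingPairs (k + 3) (k + 3) S).ncard := by
    calc n.choose (2 * (k + 3)) * 2 ^ (k + 3)
        = ∑ U ∈ S.powersetCard (2 * (k + 3)), 2 ^ (k + 3) := by
          rw [sum_const, card_powersetCard, hS, smul_eq_mul]
      _ ≤ ∑ U ∈ S.powersetCard (2 * (k + 3)), 32 * #{q ∈ Y | q.1 ∪ q.2 = U} := sum_le_sum hfib2
      _ = 32 * #Y := by rw [← mul_sum, ← hfib]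
      _ ≤ _ := by omega
  have htot' : (n.choose (2 * (k + 3)) : ℝ) * 2 ^ (k + 3) ≤
      64 * ((crossingPairs (k + 3) (k + 3) S).ncard : ℝ) := by exact_mod_cast htot
  have hlog := log_le (k + 3) (by omega)
  have hnn : (0 : ℝ) ≤ (n.choose (2 * (k + 3)) : ℝ) * 2 ^ (k + 3) := by positivity
  have := mul_le_mul_of_nonneg_left hlog hnn
  calc _ = 1 / 128 * ((n.choose (2 * (k + 3)) : ℝ) * 2 ^ (k + 3) *
        (Real.log ((k + 3 : ℕ) : ℝ) / Real.sqrt ((k + 3 : ℕ) : ℝ))) := by ring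
    _ ≤ _ := by linarith
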